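/- The Whitney immersion j : Sⁿ → ℂⁿ, j(x,y) = (1 + 2iy)x on Sⁿ = {(x,y) ∈ ℝⁿ × ℝ : ‖x‖² + y² = 1}, fails to be injective only at the poles: if p = (x,y) and q = (x',y') are distinct points of Sⁿ with j(p) = j(q), then x = x' = 0, i.e. {p,q} = {(0,1), (0,−1)} (both poles are mapped to 0 ∈ ℂⁿ). In particular j restricted to Sⁿ \ {(0,1),(0,−1)} is injective. -/

import Mathlib

open Complex

/-- The Whitney immersion `j(x,y) = (1 + 2iy)x` of the sphere
`Sⁿ = {(x,y) ∈ ℝⁿ × ℝ : ‖x‖² + y² = 1}` into `ℂⁿ`. -/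
noncomputable def whitneyMap (n : ℕ) (x : Fin n → ℝ) (y : ℝ) : Fin n → ℂ :=
  fun i => (1 + 2 * I * (y : ℂ)) * (x i : ℂ)

theorem sq_one_cases {a : ℝ} (h : a ^ 2 = 1) : a = 1 ∨ a = -1 := by
  have h' : (a - 1) * (a + 1) = 0 := by linarith [h, sq a]
  rcases mul_eq_zero.mp h' with h | h
  · left; linarith
  · right; linarith

/-- The Whitney immersion `j(x,y) = (1+2iy)x` fails to be injective only at the poles:
if two distinct points of `Sⁿ` have the same image, then both are of the form
`(0, ±1)`, i.e. they are the north and south poles (both mapped to `0 ∈ ℂⁿ`).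
In particular `j` is injective away from the poles. -/
theorem whitneyMap_injective_off_poles (n : ℕ) (x x' : Fin n → ℝ) (y y' : ℝ)
    (hp : (∑ i, x i ^ 2) + y ^ 2 = 1) (hq : (∑ i, x' i ^ 2) + y' ^ 2 = 1)
    (hne : (x, y) ≠ (x', y'))
    (heq : whitneyMap n x y = whitneyMap n x' y') :
    x = 0 ∧ x' = 0 ∧ ((y = 1 ∧ y' = -1) ∨ (y = -1 ∧ y' = 1)) := by
  have hx : x = x' := by
    funext i
    have h := congrArg Complex.re (congrFun heq i)
    simpa [whitneyMap] using h
  subst hx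
  have hy : y ≠ y' := fun h => hne (by rw [h])
  have hx0 : x = 0 := by
    funext i
    have h := congrArg Complex.im (congrFun heq i)
    simp [whitneyMap] at h
    rcases h with h | h
    · exact absurd h hy
    · exact h
  subst hx0
  have h1 : y ^ 2 = 1 := by simpa using hp
  have h2 : y' ^ 2 = 1 := by simpa using hq
  refine ⟨rfl, rfl, ?_⟩
  rcases sq_one_cases h1 with a | a <;>
    rcases sq_one_cases h2 with b | b
  · exact absurd (a.trans b.symm) hy
  · exact Or.inl ⟨a, b⟩
  · exact Or.inr ⟨a, b⟩
  · exact absurd (a.trans b.symm) hy
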